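/- Let f be a log-concave probability density on ℝ^d satisfying the pointwise bound f(x) ≤ K·exp(−‖x‖) for a constant K. Then for every unit vector v and every κ' > 0, ∫_{ℝ^d} |f(x) − f(x + κ'v)| dx ≤ c·κ' for a constant c depending only on K and d. In particular f has shift invariance SI(f, κ) ≤ c for all κ > 0. -/

import Mathlib

open MeasureTheory

/-- The exponential envelope is integrable. -/
lemma expEnvelope_integrable (d : ℕ) :
    Integrable (fun x : EuclideanSpace ℝ (Fin d) => Real.exp (-‖x‖)) := by
  have h := integrable_one_add_norm (E := EuclideanSpace ℝ (Fin d)) (μ := volume)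
    (r := ((d + 1 : ℕ) : ℝ)) (by simp)
  refine (h.const_mul (Real.exp 1 * (d + 1).factorial)).mono'
    (by fun_prop) (Filter.Eventually.of_forall fun x => ?_)
  have hx : 0 < 1 + ‖x‖ := by positivity
  rw [Real.norm_of_nonneg (Real.exp_pos _).le, Real.rpow_neg hx.le, Real.rpow_natCast,
    ← div_eq_mul_inv, le_div_iff₀ (by positivity)]
  have h1 := Real.pow_div_factorial_le_exp (1 + ‖x‖) hx.le (d + 1)
  rw [div_le_iff₀ (by positivity), Real.exp_add] at h1
  calc Real.exp (-‖x‖) * (1 + ‖x‖) ^ (d + 1)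
      ≤ Real.exp (-‖x‖) * (Real.exp 1 * Real.exp ‖x‖ * (d + 1).factorial) := by gcongr
    _ = (Real.exp (-‖x‖) * Real.exp ‖x‖) * (Real.exp 1 * (d + 1).factorial) := by ring
    _ = _ := by rw [← Real.exp_add]; simp

/-- One-dimensional shift bound for quasi-concave functions. -/
lemma unimodal_shift (l : ℝ → ℝ) (M h : ℝ) (hh : 0 < h) (h0 : ∀ t, 0 ≤ l t) (hM : ∀ t, l t ≤ M)
    (hq : ∀ a b c, a ≤ b → b ≤ c → min (l a) (l c) ≤ l b) :
    ∫⁻ t, ENNReal.ofReal |l t - l (t + h)| ≤ ENNReal.ofReal (2 * h) * ENNReal.ofReal M := by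
  have hm : Measurable l := by
    refine measurable_of_Ioi fun s => Set.OrdConnected.measurableSet ⟨?_⟩
    intro a ha c hc b hb
    exact lt_of_lt_of_le (lt_min ha hc) (hq a b c hb.1 hb.2)
  have hm2 : Measurable fun t => l (t + h) := by fun_prop
  let R := regionBetween (fun t => min (l t) (l (t + h))) (fun t => max (l t) (l (t + h))) Set.univ
  have hR : MeasurableSet R :=
    measurableSet_regionBetween (hm.min hm2) (hm.max hm2) MeasurableSet.univ
  have e1 : ∫⁻ t, ENNReal.ofReal |l t - l (t + h)| = (volume.prod volume) R := by
    rw [volume_regionBetween_eq_lintegral' (hm.min hm2) (hm.max hm2) MeasurableSet.univ,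
      Measure.restrict_univ]
    refine lintegral_congr fun t => ?_
    simp [max_sub_min_eq_abs']
  rw [e1, Measure.prod_apply_symm hR]
  have hs : ∀ s : ℝ, volume ((fun t => (t, s)) ⁻¹' R) ≤
      (Set.Icc 0 M).indicator (fun _ => ENNReal.ofReal (2 * h)) s := by
    intro s
    by_cases hsM : s ∈ Set.Icc 0 M
    · rw [Set.indicator_of_mem hsM]
      have hsub : ((fun t => (t, s)) ⁻¹' R) ⊆
          {t | s < l t ∧ l (t + h) < s} ∪ {t | l t < s ∧ s < l (t + h)} := by
        rintro t ⟨-, h1, h2⟩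
        simp only [min_lt_iff, lt_max_iff] at h1 h2
        simp only [Set.mem_union, Set.mem_setOf_eq]
        rcases h1 with h1 | h1 <;> rcases h2 with h2 | h2
        · exact absurd h1 h2.not_gt
        · exact Or.inr ⟨h1, h2⟩
        · exact Or.inl ⟨h2, h1⟩
        · exact absurd h1 h2.not_gt
      have hA : volume {t | s < l t ∧ l (t + h) < s} ≤ ENNReal.ofReal h := by
        refine (Real.volume_le_diam _).trans (Metric.ediam_le_of_forall_dist_le ?_)
        have key : ∀ a b, s < l a → l (a + h) < s → s < l b → b - a ≤ h := by
          intro a b h1 h2 h3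
          by_contra hc
          have := hq a (a + h) b (by linarith) (by linarith)
          exact absurd (lt_of_lt_of_le (lt_min h1 h3) this) h2.not_gt
        rintro a ⟨ha1, ha2⟩ b ⟨hb1, hb2⟩
        rw [Real.dist_eq, abs_le]
        have := key a b ha1 ha2 hb1
        have := key b a hb1 hb2 ha1
        constructor <;> linarith
      have hB : volume {t | l t < s ∧ s < l (t + h)} ≤ ENNReal.ofReal h := by
        refine (Real.volume_le_diam _).trans (Metric.ediam_le_of_forall_dist_le ?_)
        have key : ∀ a b, s < l (a + h) → l b < s → s < l (b + h) → b - a ≤ h := by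
          intro a b h1 h2 h3
          by_contra hc
          have := hq (a + h) b (b + h) (by linarith) (by linarith)
          exact absurd (lt_of_lt_of_le (lt_min h1 h3) this) h2.not_gt
        rintro a ⟨ha1, ha2⟩ b ⟨hb1, hb2⟩
        rw [Real.dist_eq, abs_le]
        have := key a b ha2 hb1 hb2
        have := key b a hb2 ha1 ha2
        constructor <;> linarith
      calc _ ≤ _ := measure_mono hsub
        _ ≤ _ := measure_union_le _ _
        _ ≤ ENNReal.ofReal h + ENNReal.ofReal h := add_le_add hA hB
        _ = _ := by rw [← ENNReal.ofReal_add hh.le hh.le, two_mul]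
    · rw [Set.indicator_of_notMem hsM]
      have : ((fun t => (t, s)) ⁻¹' R) = ∅ := by
        rw [Set.eq_empty_iff_forall_notMem]
        rintro t ⟨-, h1, h2⟩
        apply hsM
        exact ⟨(le_min (h0 _) (h0 _)).trans h1.le, h2.le.trans (max_le (hM _) (hM _))⟩
      rw [this]; simp
  calc _ ≤ ∫⁻ s, (Set.Icc 0 M).indicator (fun _ => ENNReal.ofReal (2 * h)) s := lintegral_mono hs
    _ = _ := by
      rw [lintegral_indicator measurableSet_Icc]; simp

/-- Averaging a function over lines in direction `v` against an exponential weight. -/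
lemma lintegral_line_average {d : ℕ} (g : EuclideanSpace ℝ (Fin d) → ENNReal)
    (hg : AEMeasurable g) (v : EuclideanSpace ℝ (Fin d)) (hv : ‖v‖ = 1) :
    ∫⁻ x, g x ≤ ∫⁻ x, ENNReal.ofReal (Real.exp (-|inner ℝ x v|)) * ∫⁻ t : ℝ, g (x + t • v) := by
  let w : ℝ → ENNReal := fun r => ENNReal.ofReal (Real.exp (-|r|))
  have hw : Measurable w := by fun_prop
  have hW : 1 ≤ ∫⁻ r, w r := by
    calc (1 : ENNReal) = ENNReal.ofReal (∫ x : ℝ in Set.Ioi 0, Real.exp (-x)) := by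
          rw [integral_exp_neg_Ioi_zero]; simp
      _ = ∫⁻ x in Set.Ioi 0, ENNReal.ofReal (Real.exp (-x)) := by
          rw [ofReal_integral_eq_lintegral_ofReal]
          · exact integrableOn_exp_neg_Ioi 0
          · exact Filter.Eventually.of_forall fun x => (Real.exp_pos _).le
      _ = ∫⁻ x in Set.Ioi 0, w x := by
          refine setLIntegral_congr_fun measurableSet_Ioi fun x hx => ?_
          simp only [w, abs_of_pos (Set.mem_Ioi.1 hx)]
      _ ≤ _ := setLIntegral_le_lintegral _ _
  have hq : Measure.QuasiMeasurePreserving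
      (fun p : ℝ × EuclideanSpace ℝ (Fin d) => p.2 + p.1 • v)
      (volume.prod volume) volume := by
    have hs : MeasurePreserving
        (fun p : ℝ × EuclideanSpace ℝ (Fin d) => (p.1, p.2 + p.1 • v))
        (volume.prod volume) (volume.prod volume) :=
      (MeasurePreserving.id volume).skew_product (g := fun t x => x + t • v) (by fun_prop)
        (Filter.Eventually.of_forall fun t => (measurePreserving_add_right volume (t • v)).map_eq)
    exact Measure.quasiMeasurePreserving_snd.comp hs.quasiMeasurePreserving
  calc ∫⁻ x, g x ≤ ∫⁻ x, g x * ∫⁻ t : ℝ, w (inner ℝ x v - t) := by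
        refine lintegral_mono fun x => ?_
        rw [lintegral_sub_left_eq_self (μ := volume) w]
        exact le_mul_of_one_le_right' hW
    _ = ∫⁻ x, ∫⁻ t : ℝ, g x * w (inner ℝ x v - t) := by
        refine lintegral_congr fun x => ?_
        rw [lintegral_const_mul]
        fun_prop
    _ = ∫⁻ t : ℝ, ∫⁻ x, g x * w (inner ℝ x v - t) := by
        refine lintegral_lintegral_swap ?_
        refine AEMeasurable.mul (hg.comp_quasiMeasurePreserving
          Measure.quasiMeasurePreserving_fst) ?_
        exact (hw.comp (by fun_prop)).aemeasurable
    _ = ∫⁻ t : ℝ, ∫⁻ x, w (inner ℝ x v) * g (x + t • v) := by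
        refine lintegral_congr fun t => ?_
        rw [← lintegral_add_right_eq_self _ (t • v)]
        refine lintegral_congr fun x => ?_
        rw [inner_add_left, inner_smul_left, real_inner_self_eq_norm_sq, hv, mul_comm]
        simp
    _ = ∫⁻ x, ∫⁻ t : ℝ, w (inner ℝ x v) * g (x + t • v) := by
        refine lintegral_lintegral_swap ?_
        refine AEMeasurable.mul ?_ (hg.comp_quasiMeasurePreserving hq)
        exact (hw.comp (by fun_prop)).aemeasurable
    _ = _ := by
        refine lintegral_congr fun x => ?_
        rw [lintegral_const_mul' _ _ ENNReal.ofReal_ne_top]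

/-- A log-concave density on `ℝ^d` with an exponential envelope
`f(x) ≤ K·e^{−‖x‖}` is shift-invariant: there is a constant `c` (depending
only on `K` and `d`) such that shifting by `κ'` in any unit direction changes
`f` by at most `c·κ'` in L¹. -/
theorem logconcave_exponential_envelope_shift_invariant
    (d : ℕ) (K : ℝ) :
    ∃ c : ℝ, ∀ f : EuclideanSpace ℝ (Fin d) → ℝ,
      (∀ x, 0 ≤ f x) → (∫ x, f x = 1) →
      (∀ x y : EuclideanSpace ℝ (Fin d), ∀ lam ∈ Set.Icc (0:ℝ) 1,
        f x ^ lam * f y ^ (1 - lam) ≤ f (lam • x + (1 - lam) • y)) →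
      (∀ x, f x ≤ K * Real.exp (-‖x‖)) →
      ∀ v : EuclideanSpace ℝ (Fin d), ‖v‖ = 1 → ∀ κ' : ℝ, 0 < κ' →
        ∫ x, |f x - f (x + κ' • v)| ≤ c * κ' := by
  refine ⟨2 * K * ∫ x : EuclideanSpace ℝ (Fin d), Real.exp (-‖x‖), ?_⟩
  intro f h0 hint hlc hK v hv h hh
  have hK0 : 0 ≤ K := by
    have := (h0 0).trans (hK 0)
    simpa using this
  have hfi : Integrable f := by
    by_contra hc
    rw [integral_undef hc] at hint
    exact zero_ne_one hint
  have hgi : Integrable fun x => |f x - f (x + h • v)| :=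
    (hfi.sub (hfi.comp_add_right (h • v))).abs
  -- quasi-concavity
  have hqc : ∀ x y : EuclideanSpace ℝ (Fin d), ∀ lam ∈ Set.Icc (0:ℝ) 1,
      min (f x) (f y) ≤ f (lam • x + (1 - lam) • y) := by
    intro x y lam hl
    rcases (le_min (h0 x) (h0 y)).eq_or_lt with hm | hm
    · rw [← hm]; exact h0 _
    · refine le_trans ?_ (hlc x y lam hl)
      have h1 : (1:ℝ) - lam ≥ 0 := by linarith [hl.2]
      calc min (f x) (f y) = min (f x) (f y) ^ lam * min (f x) (f y) ^ (1 - lam) := by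
            rw [← Real.rpow_add hm]; simp
        _ ≤ _ := mul_le_mul (Real.rpow_le_rpow hm.le (min_le_left _ _) hl.1)
            (Real.rpow_le_rpow hm.le (min_le_right _ _) h1) (by positivity)
            (Real.rpow_nonneg (h0 x) _)
  have hline : ∀ x, ∫⁻ t : ℝ, ENNReal.ofReal |f (x + t • v) - f (x + t • v + h • v)| ≤
      ENNReal.ofReal (2 * h) * ENNReal.ofReal (K * Real.exp (-‖x - inner ℝ x v • v‖)) := by
    intro x
    have := unimodal_shift (fun t => f (x + t • v)) (K * Real.exp (-‖x - inner ℝ x v • v‖)) h hh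
      (fun t => h0 _) ?_ ?_
    · simpa only [add_smul, add_assoc] using this
    · intro t
      refine (hK _).trans ?_
      gcongr
      have e : x + t • v = (x - inner ℝ x v • v) + (inner ℝ x v + t) • v := by
        rw [add_smul]; abel
      have ho : inner ℝ (x - inner ℝ x v • v) ((inner ℝ x v + t) • v) = 0 := by
        rw [inner_smul_right, inner_sub_left, inner_smul_left, real_inner_self_eq_norm_sq, hv]
        simp
      have hp := norm_add_sq_eq_norm_sq_add_norm_sq_real ho
      rw [← e] at hp
      nlinarith [norm_nonneg (x + t • v), norm_nonneg (x - inner ℝ x v • v),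
        mul_self_nonneg ‖(inner ℝ x v + t) • v‖]
    · intro a b c hab hbc
      rcases hab.eq_or_lt with rfl | hab'
      · exact min_le_left _ _
      · have hac : 0 < c - a := by linarith
        have := hqc (x + a • v) (x + c • v) ((c - b) / (c - a))
          ⟨by apply div_nonneg <;> linarith, by rw [div_le_one hac]; linarith⟩
        convert this using 2
        have hb : b = (c - b) / (c - a) * a + (1 - (c - b) / (c - a)) * c := by
          field_simp; ring
        generalize (c - b) / (c - a) = q at hb
        rw [hb]
        module
  rw [integral_eq_lintegral_of_nonneg_ae (Filter.Eventually.of_forall fun x => abs_nonneg _)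
    hgi.aestronglyMeasurable]
  have hI : 0 ≤ ∫ x : EuclideanSpace ℝ (Fin d), Real.exp (-‖x‖) :=
    integral_nonneg fun x => (Real.exp_pos _).le
  refine ENNReal.toReal_le_of_le_ofReal (by positivity) ?_
  calc ∫⁻ x, ENNReal.ofReal |f x - f (x + h • v)|
      ≤ ∫⁻ x, ENNReal.ofReal (Real.exp (-|inner ℝ x v|)) *
          ∫⁻ t : ℝ, ENNReal.ofReal |f (x + t • v) - f (x + t • v + h • v)| :=
        lintegral_line_average _ hgi.aestronglyMeasurable.aemeasurable.ennreal_ofReal v hv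
    _ ≤ ∫⁻ x, ENNReal.ofReal (2 * K * h) * ENNReal.ofReal (Real.exp (-‖x‖)) := by
        refine lintegral_mono fun x => ?_
        refine (mul_le_mul_right (hline x) _).trans ?_
        rw [← ENNReal.ofReal_mul (by positivity), ← ENNReal.ofReal_mul (by positivity),
          ← ENNReal.ofReal_mul (by positivity)]
        apply ENNReal.ofReal_le_ofReal
        have hn : ‖x‖ ≤ |inner ℝ x v| + ‖x - inner ℝ x v • v‖ := by
          calc ‖x‖ = ‖inner ℝ x v • v + (x - inner ℝ x v • v)‖ := by congr 1; abel
            _ ≤ _ := norm_add_le _ _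
            _ = _ := by rw [norm_smul, hv, mul_one, Real.norm_eq_abs]
        calc Real.exp (-|inner ℝ x v|) * (2 * h * (K * Real.exp (-‖x - inner ℝ x v • v‖)))
            = 2 * K * h * Real.exp (-(|inner ℝ x v| + ‖x - inner ℝ x v • v‖)) := by
              rw [neg_add, Real.exp_add]; ring
          _ ≤ _ := by gcongr
    _ = _ := by
        rw [lintegral_const_mul' _ _ ENNReal.ofReal_ne_top,
          ← ofReal_integral_eq_lintegral_ofReal (expEnvelope_integrable d)
            (Filter.Eventually.of_forall fun x => (Real.exp_pos _).le),
          ← ENNReal.ofReal_mul (by positivity)]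
        congr 1; ring
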